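/- arXiv:1907.05142 — 2 statements merged into one kernel-verified Lean document; each statement's English description precedes it below -/
import Mathlib

section
/- Fix real numbers r ≥ q ≥ 0 and let θ⁺ ≤ λ⁺−1. Then there exists θ⁻ < λ⁻ with f⁺(θ⁺) + f⁻(θ⁻) = r − q if and only if r − q < f⁺(θ⁺) < r − q − α⁻·Γ(−β⁻); moreover, in case of existence such θ⁻ is unique. -/
open Set

open Real Filter Topology

lemma gamma_neg_of_mem_Ioo {b : ℝ} (hb : b ∈ Set.Ioo (0 : ℝ) 1) : Real.Gamma (-b) < 0 := by
  have h := Real.Gamma_add_one (s := -b) (by linarith [hb.1])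
  have hpos := Real.Gamma_pos_of_pos (s := -b + 1) (by linarith [hb.2])
  rw [h] at hpos
  nlinarith [hb.1]

lemma continuous_rpow_increment {b : ℝ} (hb : 0 < b) :
    Continuous fun x : ℝ => (x + 1) ^ b - x ^ b :=
  ((Real.continuous_rpow_const hb.le).comp (continuous_id.add continuous_const)).sub
    (Real.continuous_rpow_const hb.le)

lemma strictAntiOn_rpow_increment {b : ℝ} (hb : b ∈ Set.Ioo (0 : ℝ) 1) :
    StrictAntiOn (fun x : ℝ => (x + 1) ^ b - x ^ b) (Set.Ici 0) := by
  refine strictAntiOn_of_deriv_neg (convex_Ici 0) (continuous_rpow_increment hb.1).continuousOn ?_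
  intro x hx
  rw [interior_Ici, Set.mem_Ioi] at hx
  have hd : HasDerivAt (fun x : ℝ => (x + 1) ^ b - x ^ b)
      (1 * b * (x + 1) ^ (b - 1) - b * x ^ (b - 1)) x :=
    (((hasDerivAt_id x).add_const 1).rpow_const (Or.inl (by simp; linarith))).sub
      (Real.hasDerivAt_rpow_const (Or.inl hx.ne'))
  rw [hd.deriv]
  have hlt : (x + 1) ^ (b - 1) < x ^ (b - 1) :=
    Real.rpow_lt_rpow_of_neg hx (by linarith) (by linarith [hb.2])
  nlinarith [hb.1]

lemma rpow_increment_le {b x : ℝ} (hb : b ∈ Set.Ioo (0 : ℝ) 1) (hx : 0 < x) :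
    (x + 1) ^ b - x ^ b ≤ x ^ (b - 1) := by
  have hinv : 0 < x⁻¹ := inv_pos.2 hx
  have hone : (1 + x⁻¹) ^ b ≤ 1 + x⁻¹ :=
    Real.rpow_le_self_of_one_le (by linarith) hb.2.le
  have hmul : (x + 1) ^ b = x ^ b * (1 + x⁻¹) ^ b := by
    rw [← Real.mul_rpow hx.le (by linarith), mul_add, mul_inv_cancel₀ hx.ne', mul_one]
  rw [hmul, Real.rpow_sub_one hx.ne', div_eq_mul_inv]
  nlinarith [Real.rpow_pos_of_pos hx b]

lemma exists_rpow_increment_eq_iff {b y : ℝ} (hb : b ∈ Set.Ioo (0 : ℝ) 1) :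
    (∃ x : ℝ, 0 < x ∧ (x + 1) ^ b - x ^ b = y) ↔ 0 < y ∧ y < 1 := by
  have hzero : ((0 : ℝ) + 1) ^ b - 0 ^ b = 1 := by
    rw [Real.zero_rpow hb.1.ne']; simp
  constructor
  · rintro ⟨x, hx, rfl⟩
    refine ⟨sub_pos.2 (Real.rpow_lt_rpow hx.le (by linarith) hb.1), ?_⟩
    have h := strictAntiOn_rpow_increment hb Set.self_mem_Ici hx.le hx
    simpa only [hzero] using h
  · rintro ⟨hy0, hy1⟩
    have hlim : Tendsto (fun x : ℝ => x ^ (b - 1)) atTop (𝓝 0) := by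
      simpa using tendsto_rpow_neg_atTop (y := 1 - b) (by linarith [hb.2])
    obtain ⟨M, hMy, hM⟩ := ((hlim.eventually_lt_const hy0).and (eventually_gt_atTop 0)).exists
    obtain ⟨x, hx, hxy⟩ := intermediate_value_Ioo' hM.le
      (continuous_rpow_increment hb.1).continuousOn
      ⟨(rpow_increment_le hb hM).trans_lt hMy, by simpa only [hzero] using hy1⟩
    exact ⟨x, hx.1, hxy⟩

/-- Fix `r ≥ q ≥ 0` and `θ⁺ ≤ λ⁺−1`. Then there exists `θ⁻ < λ⁻` with
`f⁺(θ⁺) + f⁻(θ⁻) = r − q` if and only if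
`r − q < f⁺(θ⁺) < r − q − α⁻Γ(−β⁻)`; moreover, such `θ⁻` is unique. -/
theorem bilateral_esscher_theta_minus_existence
    (ap lp am lm bp bm r q : ℝ)
    (hap : 0 < ap) (hlp : 0 < lp) (ham : 0 < am) (hlm : 0 < lm)
    (hbp : bp ∈ Set.Ioo (0 : ℝ) 1) (hbm : bm ∈ Set.Ioo (0 : ℝ) 1)
    (hrq : r ≥ q) (hq : q ≥ 0)
    (fp fm : ℝ → ℝ)
    (hfp : ∀ θ, fp θ =
      ap * Real.Gamma (-bp) * ((lp - θ - 1) ^ bp - (lp - θ) ^ bp))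
    (hfm : ∀ θ, fm θ =
      am * Real.Gamma (-bm) * ((lm - θ + 1) ^ bm - (lm - θ) ^ bm))
    (θp : ℝ) (hθp : θp ≤ lp - 1) :
    ((∃ θm : ℝ, θm < lm ∧ fp θp + fm θm = r - q) ↔
        (r - q < fp θp ∧ fp θp < r - q - am * Real.Gamma (-bm))) ∧
      ∀ θm₁ θm₂ : ℝ, θm₁ < lm → θm₂ < lm →
        fp θp + fm θm₁ = r - q → fp θp + fm θm₂ = r - q → θm₁ = θm₂ := by
  have hc : 0 < am * -Real.Gamma (-bm) := mul_pos ham (neg_pos.2 (gamma_neg_of_mem_Ioo hbm))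
  have heq : ∀ θ, fp θp + fm θ = r - q ↔
      (lm - θ + 1) ^ bm - (lm - θ) ^ bm = (fp θp - (r - q)) / (am * -Real.Gamma (-bm)) := by
    intro θ
    rw [eq_div_iff hc.ne', hfm]
    constructor <;> intro h <;> linarith
  constructor
  · have hiff := exists_rpow_increment_eq_iff
      (y := (fp θp - (r - q)) / (am * -Real.Gamma (-bm))) hbm
    rw [div_pos_iff_of_pos_right hc, div_lt_one hc] at hiff
    trans ∃ x : ℝ, 0 < x ∧
        (x + 1) ^ bm - x ^ bm = (fp θp - (r - q)) / (am * -Real.Gamma (-bm))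
    · constructor
      · rintro ⟨θ, hθ, h⟩
        exact ⟨lm - θ, sub_pos.2 hθ, (heq θ).1 h⟩
      · rintro ⟨x, hx, h⟩
        exact ⟨lm - x, by linarith, (heq _).2 (by simpa only [sub_sub_cancel] using h)⟩
    · rw [hiff]
      constructor <;> rintro ⟨h₁, h₂⟩ <;> constructor <;> linarith
  · intro θ₁ θ₂ h₁ h₂ e₁ e₂
    have h := (strictAntiOn_rpow_increment hbm).injOn (sub_pos.2 h₁).le (sub_pos.2 h₂).le
      (((heq θ₁).1 e₁).trans ((heq θ₂).1 e₂).symm)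
    linarith
end

section
/- Fix real numbers r ≥ q ≥ 0. Let θ₁⁺ < θ₂⁺ be two reals with θᵢ⁺ ≤ λ⁺−1, and let θ₁⁻, θ₂⁻ < λ⁻ satisfy f⁺(θᵢ⁺) + f⁻(θᵢ⁻) = r − q for i = 1, 2. Then θ₁⁻ < θ₂⁻. In other words, the implicitly defined map Φ sending θ⁺ to the unique solution θ⁻ of the martingale equation is strictly increasing. -/
open Set

/-- Unit increments of a strictly concave power function strictly decrease. -/
theorem strictAntiOn_rpow_add_one_sub_rpow {b : ℝ} (hb : b ∈ Ioo (0 : ℝ) 1) :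
    StrictAntiOn (fun x : ℝ => (x + 1) ^ b - x ^ b) (Ici 0) := by
  intro x hx y hy hxy
  have hx0 : 0 ≤ x := hx
  have hconc := Real.strictConcaveOn_rpow hb.1 hb.2
  have hd : 0 < y + 1 - x := by linarith
  have ht : 0 < 1 / (y + 1 - x) := by positivity
  have hs : 0 < (y - x) / (y + 1 - x) := div_pos (by linarith) hd
  have hts : 1 / (y + 1 - x) + (y - x) / (y + 1 - x) = 1 := by field_simp; ring
  have hz : y + 1 ∈ Ici (0 : ℝ) := by simp only [mem_Ici]; linarith
  have hne : x ≠ y + 1 := by linarith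
  have h1 := hconc.2 hx hz hne ht hs hts
  have h2 := hconc.2 hx hz hne hs ht (by linarith)
  simp only [smul_eq_mul] at h1 h2
  rw [show 1 / (y + 1 - x) * x + (y - x) / (y + 1 - x) * (y + 1) = y by
    field_simp; ring] at h1
  rw [show (y - x) / (y + 1 - x) * x + 1 / (y + 1 - x) * (y + 1) = x + 1 by
    field_simp; ring] at h2
  have hsum : x ^ b + (y + 1) ^ b < y ^ b + (x + 1) ^ b := by
    calc x ^ b + (y + 1) ^ b
        = (1 / (y + 1 - x) + (y - x) / (y + 1 - x)) * (x ^ b + (y + 1) ^ b) := by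
          rw [hts, one_mul]
      _ < y ^ b + (x + 1) ^ b := by linarith
  show (y + 1) ^ b - y ^ b < (x + 1) ^ b - x ^ b
  linarith

theorem Real.Gamma_neg_of_mem_Ioo {b : ℝ} (hb : b ∈ Ioo (0 : ℝ) 1) :
    Real.Gamma (-b) < 0 := by
  have h := Real.Gamma_add_one (neg_ne_zero.mpr hb.1.ne')
  have hpos : 0 < Real.Gamma (-b + 1) := Real.Gamma_pos_of_pos (by linarith [hb.2])
  rw [h] at hpos
  exact neg_of_mul_pos_right hpos (by linarith [hb.1])

/-- Fix `r ≥ q ≥ 0`. If `θ₁⁺ < θ₂⁺ ≤ λ⁺−1` and `θ₁⁻, θ₂⁻ < λ⁻` satisfy the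
martingale equations `f⁺(θᵢ⁺) + f⁻(θᵢ⁻) = r − q`, then `θ₁⁻ < θ₂⁻`; i.e. the
implicit map `Φ : θ⁺ ↦ θ⁻` is strictly increasing. -/
theorem bilateral_esscher_Phi_strictMono
    (ap lp am lm bp bm r q : ℝ)
    (hap : 0 < ap) (hlp : 0 < lp) (ham : 0 < am) (hlm : 0 < lm)
    (hbp : bp ∈ Set.Ioo (0 : ℝ) 1) (hbm : bm ∈ Set.Ioo (0 : ℝ) 1)
    (hrq : r ≥ q) (hq : q ≥ 0)
    (fp fm : ℝ → ℝ)
    (hfp : ∀ θ, fp θ =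
      ap * Real.Gamma (-bp) * ((lp - θ - 1) ^ bp - (lp - θ) ^ bp))
    (hfm : ∀ θ, fm θ =
      am * Real.Gamma (-bm) * ((lm - θ + 1) ^ bm - (lm - θ) ^ bm))
    (θp₁ θp₂ θm₁ θm₂ : ℝ)
    (h12 : θp₁ < θp₂) (h1 : θp₁ ≤ lp - 1) (h2 : θp₂ ≤ lp - 1)
    (hm1 : θm₁ < lm) (hm2 : θm₂ < lm)
    (heq1 : fp θp₁ + fm θm₁ = r - q) (heq2 : fp θp₂ + fm θm₂ = r - q) :
    θm₁ < θm₂ := by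
  have hcp : ap * Real.Gamma (-bp) < 0 :=
    mul_neg_of_pos_of_neg hap (Real.Gamma_neg_of_mem_Ioo hbp)
  have hcm : am * Real.Gamma (-bm) < 0 :=
    mul_neg_of_pos_of_neg ham (Real.Gamma_neg_of_mem_Ioo hbm)
  have hfp_lt : fp θp₁ < fp θp₂ := by
    have h := strictAntiOn_rpow_add_one_sub_rpow hbp
      (show lp - θp₂ - 1 ∈ Ici 0 by simp only [mem_Ici]; linarith)
      (show lp - θp₁ - 1 ∈ Ici 0 by simp only [mem_Ici]; linarith) (by linarith)
    simp only [sub_add_cancel] at h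
    rw [hfp, hfp]
    exact mul_lt_mul_of_neg_left (by linarith) hcp
  by_contra! hle
  have hfm_le : fm θm₁ ≤ fm θm₂ := by
    have h := (strictAntiOn_rpow_add_one_sub_rpow hbm).antitoneOn
      (show lm - θm₁ ∈ Ici 0 by simp only [mem_Ici]; linarith)
      (show lm - θm₂ ∈ Ici 0 by simp only [mem_Ici]; linarith) (by linarith)
    rw [hfm, hfm]
    exact mul_le_mul_of_nonpos_left h hcm.le
  linarith
end
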